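/- Let d ≥ 2 be an integer, λ a real number, and p a real number with p > 1, p ≠ 2, p ≠ d+3. Set θ = (d−1)²(p−1)/(d(d+2)+p−1), β = (d+2)/(d+3−p), κ = 1+β(p−2), and for a positive function w let Q w := Hess w − (Δw/d)·Id − (1/θ)·((d−1)/(d+2))·(κ+β−1)·[ (∇w⊗∇w)/w − (|∇w|²/(d·w))·Id ]. Let u : ℝ × ℝ^d → ℝ be smooth, positive, ℤ^d-periodic in x, and satisfy ∂ₜu = u^{2−2β}·(Δₓu + κ·|∇ₓu|²/u), and define F(t) = ∫_{[0,1]^d} |∇ₓ(u(t,·)^β)|² dx + (λ/(p−2))·[∫_{[0,1]^d} u^{2β} dx − (∫_{[0,1]^d} u^{βp} dx)^{2/p}]. Then for every t, F'(t) = 2β²·( −(1−θ)·∫_{[0,1]^d} (Δu)² dx − (θd/(d−1))·∫_{[0,1]^d} ‖Q u(t,·)‖² dx + λ·∫_{[0,1]^d} |∇u|² dx ). -/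

import Mathlib

open MeasureTheory

/-- The i-th partial derivative of f : ℝ^d → ℝ. -/
noncomputable def pd {d : ℕ} (i : Fin d) (f : (Fin d → ℝ) → ℝ) (x : Fin d → ℝ) : ℝ :=
  fderiv ℝ f x (Pi.single i 1)

/-- The Laplacian of f : ℝ^d → ℝ. -/
noncomputable def lap {d : ℕ} (f : (Fin d → ℝ) → ℝ) (x : Fin d → ℝ) : ℝ :=
  ∑ i, pd i (pd i f) x

/-- The (i,j) entry of the trace-free Hessian L w = Hess w − (Δw/d)·Id. -/
noncomputable def traceFreeHess {d : ℕ} (w : (Fin d → ℝ) → ℝ) (i j : Fin d)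
    (x : Fin d → ℝ) : ℝ :=
  pd i (pd j w) x - (if i = j then lap w x / d else 0)

/-- The (i,j) entry of
Q w = L w − (1/θ)((d−1)/(d+2))(κ+β−1)[(∇w⊗∇w)/w − (|∇w|²/(d·w))·Id]. -/
noncomputable def Qmat {d : ℕ} (θ β κ : ℝ) (w : (Fin d → ℝ) → ℝ) (i j : Fin d)
    (x : Fin d → ℝ) : ℝ :=
  traceFreeHess w i j x
    - (1 / θ) * (((d : ℝ) - 1) / ((d : ℝ) + 2)) * (κ + β - 1) *
      (pd i w x * pd j w x / w x
        - (if i = j then (∑ k, (pd k w x) ^ 2) / ((d : ℝ) * w x) else 0))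

/-- `f` is invariant under translations by `ℤ^d`. -/
def IsLatticePeriodic {d : ℕ} (f : (Fin d → ℝ) → ℝ) : Prop :=
  ∀ (x : Fin d → ℝ) (k : Fin d → ℤ), f (x + fun i => (k i : ℝ)) = f x

section DirectionalDerivative

variable {E : Type*} [NormedAddCommGroup E] [NormedSpace ℝ E]

theorem ContDiff.fderiv_apply_const {f : E → ℝ} (hf : ContDiff ℝ (⊤ : ℕ∞) f) (v : E) :
    ContDiff ℝ (⊤ : ℕ∞) (fun z => fderiv ℝ f z v) :=
  (hf.fderiv_right (m := (⊤ : ℕ∞)) (by simp)).clm_apply contDiff_const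

theorem ContDiff.fderiv_fderiv_apply_comm {f : E → ℝ} (hf : ContDiff ℝ (⊤ : ℕ∞) f) (v w z : E) :
    fderiv ℝ (fun z => fderiv ℝ f z v) z w = fderiv ℝ (fun z => fderiv ℝ f z w) z v := by
  have hd : DifferentiableAt ℝ (fderiv ℝ f) z :=
    ((hf.fderiv_right (m := (⊤ : ℕ∞)) (by simp)).differentiable (by simp)) z
  have hs : IsSymmSndFDerivAt ℝ f z := hf.contDiffAt.isSymmSndFDerivAt (by
    simpa using WithTop.coe_le_coe.2 (le_top : (2 : ℕ∞) ≤ ⊤))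
  rw [fderiv_clm_apply hd (differentiableAt_const v),
    fderiv_clm_apply hd (differentiableAt_const w)]
  simpa using hs w v

end DirectionalDerivative

section PartialDerivative

variable {d : ℕ} {f g : (Fin d → ℝ) → ℝ}

theorem ContDiff.pd (hf : ContDiff ℝ (⊤ : ℕ∞) f) (i : Fin d) :
    ContDiff ℝ (⊤ : ℕ∞) (pd i f) :=
  hf.fderiv_apply_const _

theorem pd_comm (hf : ContDiff ℝ (⊤ : ℕ∞) f) (i j : Fin d) (x : Fin d → ℝ) :
    pd i (pd j f) x = pd j (pd i f) x :=
  hf.fderiv_fderiv_apply_comm _ _ x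

theorem ContDiff.lap (hf : ContDiff ℝ (⊤ : ℕ∞) f) : ContDiff ℝ (⊤ : ℕ∞) (lap f) :=
  ContDiff.sum fun i _ => (hf.pd i).pd i

theorem IsLatticePeriodic.pd (hf : IsLatticePeriodic f) (i : Fin d) :
    IsLatticePeriodic (pd i f) := by
  intro x k
  have h : (fun y => f (y + fun i => (k i : ℝ))) = f := funext fun y => hf y k
  have h2 := fderiv_comp_add_right (𝕜 := ℝ) (f := f) (x := x) (fun i => (k i : ℝ))
  rw [h] at h2
  simp only [_root_.pd, h2]

theorem IsLatticePeriodic.lap (hf : IsLatticePeriodic f) : IsLatticePeriodic (lap f) :=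
  fun x k => Finset.sum_congr rfl fun i _ => (hf.pd i).pd i x k

theorem pd_mul {x : Fin d → ℝ} (hf : DifferentiableAt ℝ f x) (hg : DifferentiableAt ℝ g x)
    (i : Fin d) : pd i (fun y => f y * g y) x = f x * pd i g x + pd i f x * g x := by
  simp [pd, fderiv_fun_mul hf hg, mul_comm]

theorem pd_sub {x : Fin d → ℝ} (hf : DifferentiableAt ℝ f x) (hg : DifferentiableAt ℝ g x)
    (i : Fin d) : pd i (fun y => f y - g y) x = pd i f x - pd i g x := by
  simp [pd, fderiv_fun_sub hf hg]

theorem pd_add {x : Fin d → ℝ} (hf : DifferentiableAt ℝ f x) (hg : DifferentiableAt ℝ g x)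
    (i : Fin d) : pd i (fun y => f y + g y) x = pd i f x + pd i g x := by
  simp [pd, fderiv_fun_add hf hg]

theorem pd_const_mul {x : Fin d → ℝ} (hf : DifferentiableAt ℝ f x) (c : ℝ)
    (i : Fin d) : pd i (fun y => c * f y) x = c * pd i f x := by
  simp [pd, fderiv_const_mul hf]

theorem pd_sum {ι : Type*} {s : Finset ι} {f : ι → (Fin d → ℝ) → ℝ} {x : Fin d → ℝ}
    (hf : ∀ j ∈ s, DifferentiableAt ℝ (f j) x) (i : Fin d) :
    pd i (fun y => ∑ j ∈ s, f j y) x = ∑ j ∈ s, pd i (f j) x := by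
  simp [pd, fderiv_fun_sum hf]

theorem pd_rpow {x : Fin d → ℝ} (hf : DifferentiableAt ℝ f x) (hx : f x ≠ 0) (q : ℝ)
    (i : Fin d) : pd i (fun y => f y ^ q) x = q * f x ^ (q - 1) * pd i f x := by
  simp [pd, (hf.hasFDerivAt.rpow_const (p := q) (Or.inl hx)).fderiv]

theorem pd_inv {x : Fin d → ℝ} (hf : DifferentiableAt ℝ f x) (hx : f x ≠ 0)
    (i : Fin d) : pd i (fun y => (f y)⁻¹) x = - pd i f x / f x ^ 2 := by
  have h := (hasDerivAt_inv hx).comp_hasFDerivAt x hf.hasFDerivAt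
  have h2 : (fun y => (f y)⁻¹) = Inv.inv ∘ f := rfl
  simp only [pd, h2, h.fderiv]
  simp
  ring

theorem pd_slice {f : ℝ × (Fin d → ℝ) → ℝ} (hf : Differentiable ℝ f) (i : Fin d) (t : ℝ)
    (x : Fin d → ℝ) :
    pd i (fun y => f (t, y)) x = fderiv ℝ f (t, x) (0, Pi.single i 1) := by
  have h := (hf (t, x)).hasFDerivAt.comp x (hasFDerivAt_prodMk_right t x)
  have h2 : (fun y => f (t, y)) = f ∘ (fun y => (t, y)) := rfl
  simp only [pd, h2, h.fderiv]
  simp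

theorem hasDerivAt_slice {f : ℝ × (Fin d → ℝ) → ℝ} (hf : Differentiable ℝ f) (t : ℝ)
    (x : Fin d → ℝ) :
    HasDerivAt (fun s => f (s, x)) (fderiv ℝ f (t, x) (1, 0)) t := by
  have h := (hf (t, x)).hasFDerivAt.comp_hasDerivAt t
    ((hasDerivAt_id t).prodMk (hasDerivAt_const t x))
  exact h

end PartialDerivative

section TorusIntegral

variable {d : ℕ}

theorem integral_sum_pd_eq_zero {X : Fin d → (Fin d → ℝ) → ℝ}
    (hX : ∀ i, ContDiff ℝ (⊤ : ℕ∞) (X i)) (hper : ∀ i, IsLatticePeriodic (X i)) :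
    ∫ x in Set.Icc (0 : Fin d → ℝ) 1, ∑ i, pd i (X i) x = 0 := by
  cases d with
  | zero => simp
  | succ n =>
    have h := integral_divergence_of_hasFDerivAt_off_countable' (0 : Fin (n + 1) → ℝ) 1
      (fun i => zero_le_one) X (fun i => fderiv ℝ (X i)) ∅ Set.countable_empty
      (fun i => (hX i).continuous.continuousOn)
      (fun x _ i => ((hX i).differentiable (by simp) x).hasFDerivAt)
      (Continuous.integrableOn_Icc
        (continuous_finsetSum _ fun i _ => ((hX i).pd i).continuous))
    refine h.trans (Finset.sum_eq_zero fun i _ => sub_eq_zero.2 ?_)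
    refine integral_congr_ae (Filter.Eventually.of_forall fun y => ?_)
    have h1 := hper i (i.insertNth 0 y) (Pi.single i 1)
    have h2 : (i.insertNth (0 : ℝ) y + fun j => (((Pi.single i 1 : Fin (n + 1) → ℤ) j : ℤ) : ℝ))
        = (i.insertNth (1 : ℝ) y : Fin (n + 1) → ℝ) := by
      ext j
      refine Fin.succAboveCases i ?_ (fun j => ?_) j <;> simp
    rw [h2] at h1
    exact h1

theorem integral_eq_of_sub_eq_sum_pd {f g : (Fin d → ℝ) → ℝ} (hf : Continuous f)
    (hg : Continuous g) {X : Fin d → (Fin d → ℝ) → ℝ}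
    (hX : ∀ i, ContDiff ℝ (⊤ : ℕ∞) (X i)) (hper : ∀ i, IsLatticePeriodic (X i))
    (h : ∀ x, f x - g x = ∑ i, pd i (X i) x) :
    ∫ x in Set.Icc (0 : Fin d → ℝ) 1, f x = ∫ x in Set.Icc (0 : Fin d → ℝ) 1, g x := by
  rw [← sub_eq_zero, ← integral_sub hf.integrableOn_Icc hg.integrableOn_Icc]
  simp only [h]
  exact integral_sum_pd_eq_zero hX hper

theorem hasDerivAt_integral_slice {G : ℝ × (Fin d → ℝ) → ℝ} (hG : ContDiff ℝ (⊤ : ℕ∞) G)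
    (t : ℝ) :
    HasDerivAt (fun s => ∫ x in Set.Icc (0 : Fin d → ℝ) 1, G (s, x))
      (∫ x in Set.Icc (0 : Fin d → ℝ) 1, fderiv ℝ G (t, x) (1, 0)) t := by
  have hG' : Continuous (fun z => fderiv ℝ G z (1, 0)) := (hG.fderiv_apply_const _).continuous
  obtain ⟨C, hC⟩ := ((isCompact_Icc (a := t - 1) (b := t + 1)).prod
    (isCompact_Icc (a := (0 : Fin d → ℝ)) (b := 1))).exists_bound_of_continuousOn
    hG'.continuousOn
  refine (hasDerivAt_integral_of_dominated_loc_of_deriv_le (𝕜 := ℝ)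
    (F' := fun s x => fderiv ℝ G (s, x) (1, 0)) (bound := fun _ => C)
    (Icc_mem_nhds (show t - 1 < t by linarith) (show t < t + 1 by linarith)) ?_ ?_ ?_ ?_ ?_ ?_).2
  · exact Filter.Eventually.of_forall fun s =>
      (hG.continuous.comp (by fun_prop : Continuous fun x => (s, x))).aestronglyMeasurable
  · exact (hG.continuous.comp (by fun_prop : Continuous fun x => (t, x))).integrableOn_Icc
  · exact (hG'.comp (by fun_prop : Continuous fun x => (t, x))).aestronglyMeasurable
  · exact (ae_restrict_iff' measurableSet_Icc).2
      (Filter.Eventually.of_forall fun x hx s hs => hC (s, x) ⟨hs, hx⟩)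
  · exact (continuous_const).integrableOn_Icc
  · exact Filter.Eventually.of_forall fun x s _ =>
      hasDerivAt_slice (hG.differentiable (by simp)) s x

end TorusIntegral

section DivergenceIdentities

variable {d : ℕ} {w : (Fin d → ℝ) → ℝ}

theorem integral_sum_pd_mul_pd {v : (Fin d → ℝ) → ℝ} (hv : ContDiff ℝ (⊤ : ℕ∞) v)
    (hw : ContDiff ℝ (⊤ : ℕ∞) w) (hv_per : IsLatticePeriodic v) (hw_per : IsLatticePeriodic w) :
    ∫ x in Set.Icc (0 : Fin d → ℝ) 1, ∑ i, pd i v x * pd i w x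
      = ∫ x in Set.Icc (0 : Fin d → ℝ) 1, -(lap v x * w x) := by
  refine integral_eq_of_sub_eq_sum_pd (X := fun i y => pd i v y * w y)
    (continuous_finsetSum _ fun i _ => (hv.pd i).continuous.mul (hw.pd i).continuous)
    (hv.lap.continuous.mul hw.continuous).neg (fun i => (hv.pd i).mul hw)
    (fun i x k => by simp only [hv_per.pd i x k, hw_per x k]) fun x => ?_
  have h : ∀ i, pd i (fun y => pd i v y * w y) x
      = pd i v x * pd i w x + pd i (pd i v) x * w x := fun i =>
    pd_mul ((hv.pd i).differentiable (by simp) x) (hw.differentiable (by simp) x) i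
  simp only [h, Finset.sum_add_distrib, lap, Finset.sum_mul, sub_neg_eq_add]

/-- The Bochner field `Δw ∇w - ∇(|∇w|²/2)` has divergence `(Δw)² - |Hess w|²`. -/
theorem sum_pd_lap_mul_pd_sub (hw : ContDiff ℝ (⊤ : ℕ∞) w) (x : Fin d → ℝ) :
    ∑ i, pd i (fun y => lap w y * pd i w y - ∑ j, pd j w y * pd i (pd j w) y) x
      = lap w x ^ 2 - ∑ i, ∑ j, pd i (pd j w) x ^ 2 := by
  have hd : ∀ {f : (Fin d → ℝ) → ℝ}, ContDiff ℝ (⊤ : ℕ∞) f → DifferentiableAt ℝ f x :=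
    fun hf => hf.differentiable (by simp) x
  have h : ∀ i, pd i (fun y => lap w y * pd i w y - ∑ j, pd j w y * pd i (pd j w) y) x
      = (lap w x * pd i (pd i w) x + pd i (lap w) x * pd i w x)
        - ∑ j, (pd j w x * pd i (pd i (pd j w)) x + pd i (pd j w) x * pd i (pd j w) x) := by
    intro i
    rw [pd_sub (hd (hw.lap.mul (hw.pd i)))
        (hd (ContDiff.sum fun j _ => (hw.pd j).mul ((hw.pd j).pd i))),
      pd_mul (hd hw.lap) (hd (hw.pd i)),
      pd_sum fun j _ => hd ((hw.pd j).mul ((hw.pd j).pd i))]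
    simp only [pd_mul (hd (hw.pd _)) (hd ((hw.pd _).pd i))]
  have h3 : ∀ i, pd i (lap w) x = ∑ j, pd j (pd j (pd i w)) x := by
    intro i
    have : lap w = fun y => ∑ j, pd j (pd j w) y := rfl
    rw [this, pd_sum fun j _ => hd ((hw.pd j).pd j)]
    refine Finset.sum_congr rfl fun j _ => ?_
    rw [pd_comm (hw.pd j) i j, show pd i (pd j w) = pd j (pd i w) from funext (pd_comm hw i j)]
  simp only [h, h3, Finset.sum_sub_distrib, Finset.sum_add_distrib, ← Finset.mul_sum]
  have h4 : ∑ i, (∑ j, pd j (pd j (pd i w)) x) * pd i w x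
      = ∑ i, ∑ j, pd j w x * pd i (pd i (pd j w)) x := by
    rw [Finset.sum_comm]
    refine Finset.sum_congr rfl fun i _ => ?_
    rw [Finset.sum_mul]
    exact Finset.sum_congr rfl fun j _ => mul_comm _ _
  have h5 : ∑ i, pd i (pd i w) x = lap w x := rfl
  rw [h4, h5]
  simp only [sq]
  ring

/-- The divergence of the field `|∇w|² ∇w / w`. -/
theorem sum_pd_normSq_mul_pd_mul_inv (hw : ContDiff ℝ (⊤ : ℕ∞) w) (hpos : ∀ x, 0 < w x)
    (x : Fin d → ℝ) :
    ∑ i, pd i (fun y => (∑ j, pd j w y ^ 2) * pd i w y * (w y)⁻¹) x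
      = 2 * (∑ i, ∑ j, pd i (pd j w) x * (pd i w x * pd j w x)) / w x
        + (∑ j, pd j w x ^ 2) * lap w x / w x - (∑ j, pd j w x ^ 2) ^ 2 / w x ^ 2 := by
  have hd : ∀ {f : (Fin d → ℝ) → ℝ}, ContDiff ℝ (⊤ : ℕ∞) f → DifferentiableAt ℝ f x :=
    fun hf => hf.differentiable (by simp) x
  have hne : ∀ x, w x ≠ 0 := fun x => (hpos x).ne'
  have hS : ContDiff ℝ (⊤ : ℕ∞) fun y => ∑ j, pd j w y ^ 2 :=
    ContDiff.sum fun j _ => (hw.pd j).pow 2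
  have hSd : ∀ i, pd i (fun y => ∑ j, pd j w y ^ 2) x
      = 2 * ∑ j, pd i (pd j w) x * pd j w x := by
    intro i
    rw [pd_sum fun j _ => hd ((hw.pd j).pow 2), Finset.mul_sum]
    refine Finset.sum_congr rfl fun j _ => ?_
    simp only [sq]
    rw [pd_mul (hd (hw.pd j)) (hd (hw.pd j))]
    ring
  have hinv : ContDiff ℝ (⊤ : ℕ∞) fun y => (w y)⁻¹ := hw.inv hne
  have h : ∀ i, pd i (fun y => (∑ j, pd j w y ^ 2) * pd i w y * (w y)⁻¹) x
      = 2 / w x * (∑ j, pd i (pd j w) x * (pd i w x * pd j w x))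
        + (∑ j, pd j w x ^ 2) / w x * pd i (pd i w) x
        - (∑ j, pd j w x ^ 2) / w x ^ 2 * pd i w x ^ 2 := by
    intro i
    rw [pd_mul (hd (hS.mul (hw.pd i))) (hd hinv), pd_mul (hd hS) (hd (hw.pd i)), hSd,
      pd_inv (hd hw) (hne x)]
    have : ∑ j, pd i (pd j w) x * (pd i w x * pd j w x)
        = (∑ j, pd i (pd j w) x * pd j w x) * pd i w x := by
      rw [Finset.sum_mul]
      exact Finset.sum_congr rfl fun j _ => by ring
    rw [this]
    have := hne x
    field_simp
    ring
  simp only [h, Finset.sum_sub_distrib, Finset.sum_add_distrib, ← Finset.mul_sum]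
  have h5 : ∑ i, pd i (pd i w) x = lap w x := rfl
  rw [h5]
  ring

theorem sum_sum_sq_sub_ite {d : ℕ} (M : Fin d → Fin d → ℝ) (m : ℝ) (hm : ∑ i, M i i = d * m) :
    ∑ i, ∑ j, (M i j - if i = j then m else 0) ^ 2 = (∑ i, ∑ j, M i j ^ 2) - d * m ^ 2 := by
  have h : ∀ i j, (M i j - if i = j then m else 0) ^ 2
      = M i j ^ 2 - (if i = j then 2 * m * M i i - m ^ 2 else 0) := by
    intro i j
    split_ifs with hij
    · subst hij
      ring
    · ring
  simp only [h, Finset.sum_sub_distrib, Finset.sum_ite_eq, Finset.mem_univ, if_true,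
    ← Finset.mul_sum, hm]
  simp
  ring

theorem sum_sum_Qmat_sq (hd : d ≠ 0) (θ β κ c : ℝ)
    (hc : c = 1 / θ * (((d : ℝ) - 1) / ((d : ℝ) + 2)) * (κ + β - 1)) {x : Fin d → ℝ}
    (hx : w x ≠ 0) :
    ∑ i, ∑ j, Qmat θ β κ w i j x ^ 2
      = (∑ i, ∑ j, pd i (pd j w) x ^ 2)
        - 2 * c * (∑ i, ∑ j, pd i (pd j w) x * (pd i w x * pd j w x)) / w x
        + c ^ 2 * (∑ j, pd j w x ^ 2) ^ 2 / w x ^ 2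
        - (lap w x - c * (∑ j, pd j w x ^ 2) / w x) ^ 2 / d := by
  have hd' : (d : ℝ) ≠ 0 := Nat.cast_ne_zero.2 hd
  have h1 : ∀ i j, Qmat θ β κ w i j x
      = (pd i (pd j w) x - c / w x * (pd i w x * pd j w x))
        - if i = j then (lap w x - c * (∑ j, pd j w x ^ 2) / w x) / d else 0 := by
    intro i j
    rw [Qmat, traceFreeHess, ← hc]
    split_ifs
    · field_simp
      ring
    · field_simp
      ring
  simp only [h1]
  rw [sum_sum_sq_sub_ite]
  · have h2 : ∀ i j, (pd i (pd j w) x - c / w x * (pd i w x * pd j w x)) ^ 2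
        = pd i (pd j w) x ^ 2 - 2 * c / w x * (pd i (pd j w) x * (pd i w x * pd j w x))
          + c ^ 2 / w x ^ 2 * (pd i w x ^ 2 * pd j w x ^ 2) := by
      intro i j
      field_simp
      ring
    simp only [h2, Finset.sum_sub_distrib, Finset.sum_add_distrib, ← Finset.mul_sum,
      ← Finset.sum_mul]
    field_simp
  · rw [Finset.sum_sub_distrib, ← Finset.mul_sum]
    simp only [← sq]
    rw [show ∑ i, pd i (pd i w) x = lap w x from rfl]
    field_simp

theorem integral_dissipation_eq (hd : 2 ≤ d) {θ β κ : ℝ} (hθ : θ ≠ 0)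
    (hμ : κ * (β - 1) = 1 / θ * (((d : ℝ) - 1) / ((d : ℝ) + 2)) ^ 2 * (κ + β - 1) ^ 2
      - d / ((d : ℝ) + 2) * (κ + β - 1))
    (hw : ContDiff ℝ (⊤ : ℕ∞) w) (hpos : ∀ x, 0 < w x) (hper : IsLatticePeriodic w) :
    ∫ x in Set.Icc (0 : Fin d → ℝ) 1,
        (lap w x + (β - 1) * (∑ i, pd i w x ^ 2) / w x)
          * (lap w x + κ * (∑ i, pd i w x ^ 2) / w x)
      = (1 - θ) * (∫ x in Set.Icc (0 : Fin d → ℝ) 1, lap w x ^ 2)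
        + θ * d / (d - 1) *
          ∫ x in Set.Icc (0 : Fin d → ℝ) 1, ∑ i, ∑ j, Qmat θ β κ w i j x ^ 2 := by
  have hne : ∀ x, w x ≠ 0 := fun x => (hpos x).ne'
  have hd0 : (d : ℝ) ≠ 0 := by positivity
  have hd1 : (d : ℝ) - 1 ≠ 0 := by
    have : (2 : ℝ) ≤ d := by exact_mod_cast hd
    linarith
  have hd2 : (d : ℝ) + 2 ≠ 0 := by positivity
  have hS : ContDiff ℝ (⊤ : ℕ∞) fun y => ∑ j, pd j w y ^ 2 :=
    ContDiff.sum fun j _ => (hw.pd j).pow 2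
  have hQ : Continuous fun x => ∑ i, ∑ j, Qmat θ β κ w i j x ^ 2 := by
    simp only [fun x => sum_sum_Qmat_sq (by lia) θ β κ _ rfl (hne x)]
    have h1 : Continuous fun x => ∑ i, ∑ j, pd i (pd j w) x ^ 2 :=
      continuous_finsetSum _ fun i _ => continuous_finsetSum _ fun j _ =>
        ((hw.pd j).pd i).continuous.pow 2
    have h2 : Continuous fun x => ∑ i, ∑ j, pd i (pd j w) x * (pd i w x * pd j w x) :=
      continuous_finsetSum _ fun i _ => continuous_finsetSum _ fun j _ =>
        ((hw.pd j).pd i).continuous.mul ((hw.pd i).continuous.mul (hw.pd j).continuous)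
    have h3 := hS.continuous
    have h4 := hw.continuous
    have h5 := hw.lap.continuous
    fun_prop (disch := simp [hne])
  have hL : Continuous fun x => lap w x ^ 2 := hw.lap.continuous.pow 2
  rw [← integral_const_mul, ← integral_const_mul,
    ← integral_add (hL.const_mul _).integrableOn_Icc (hQ.const_mul _).integrableOn_Icc]
  have hX1 : ∀ i, ContDiff ℝ (⊤ : ℕ∞)
      fun y => lap w y * pd i w y - ∑ j, pd j w y * pd i (pd j w) y := fun i =>
    (hw.lap.mul (hw.pd i)).sub (ContDiff.sum fun j _ => (hw.pd j).mul ((hw.pd j).pd i))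
  have hX2 : ∀ i, ContDiff ℝ (⊤ : ℕ∞)
      fun y => (∑ j, pd j w y ^ 2) * pd i w y * (w y)⁻¹ := fun i =>
    (hS.mul (hw.pd i)).mul (hw.inv hne)
  refine integral_eq_of_sub_eq_sum_pd
    (X := fun i y => θ * d / (d - 1) * (lap w y * pd i w y - ∑ j, pd j w y * pd i (pd j w) y)
      + d / ((d : ℝ) + 2) * (κ + β - 1) * ((∑ j, pd j w y ^ 2) * pd i w y * (w y)⁻¹))
    ?_ ((hL.const_mul _).add (hQ.const_mul _)) ?_ ?_ fun x => ?_
  · have h3 := hS.continuous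
    have h4 := hw.continuous
    have h5 := hw.lap.continuous
    fun_prop (disch := simp [hne])
  · exact fun i => (contDiff_const.mul (hX1 i)).add (contDiff_const.mul (hX2 i))
  · intro i x k
    simp only [hper.lap x k, (hper.pd _) x k, ((hper.pd _).pd i) x k, hper x k]
  · have hdX1 := fun i => (hX1 i).differentiable (by simp) x
    have hdX2 := fun i => (hX2 i).differentiable (by simp) x
    simp only [pd_add ((hdX1 _).const_mul _) ((hdX2 _).const_mul _), pd_const_mul (hdX1 _),
      pd_const_mul (hdX2 _), Finset.sum_add_distrib, ← Finset.mul_sum]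
    rw [sum_pd_lap_mul_pd_sub hw, sum_pd_normSq_mul_pd_mul_inv hw hpos,
      sum_sum_Qmat_sq (by lia) θ β κ _ rfl (hne x)]
    have := hne x
    generalize (∑ i, ∑ j, pd i (pd j w) x ^ 2) = H
    generalize (∑ i, ∑ j, pd i (pd j w) x * (pd i w x * pd j w x)) = K
    generalize (∑ j, pd j w x ^ 2) = S
    generalize lap w x = L
    generalize w x = W at *
    have h6 : (L + (β - 1) * S / W) * (L + κ * S / W)
        = L ^ 2 + (κ + β - 1) * (S / W) * L + κ * (β - 1) * (S / W) ^ 2 := by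
      field_simp
      ring
    rw [h6, hμ]
    generalize κ + β - 1 = A
    field_simp
    ring

end DivergenceIdentities

section Flow

variable {d : ℕ} {w : (Fin d → ℝ) → ℝ}

theorem ContDiff.rpow_of_pos {E : Type*} [NormedAddCommGroup E] [NormedSpace ℝ E] {f : E → ℝ}
    (hf : ContDiff ℝ (⊤ : ℕ∞) f) (hpos : ∀ z, 0 < f z) (q : ℝ) :
    ContDiff ℝ (⊤ : ℕ∞) fun z => f z ^ q :=
  hf.rpow_const_of_ne fun z => (hpos z).ne'

theorem lap_rpow (hw : ContDiff ℝ (⊤ : ℕ∞) w) (hpos : ∀ x, 0 < w x) (q : ℝ) (x : Fin d → ℝ) :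
    lap (fun y => w y ^ q) x
      = q * w x ^ (q - 1) * (lap w x + (q - 1) * (∑ i, pd i w x ^ 2) / w x) := by
  have h1 : ∀ i, pd i (fun y => w y ^ q) = fun y => q * (w y ^ (q - 1) * pd i w y) := fun i =>
    funext fun y => by
      rw [pd_rpow (hw.differentiable (by simp) y) (hpos y).ne', mul_assoc]
  have h2 : ∀ i, pd i (pd i fun y => w y ^ q) x
      = q * w x ^ (q - 1) * pd i (pd i w) x
        + q * w x ^ (q - 1) * ((q - 1) / w x) * pd i w x ^ 2 := by
    intro i
    have hr := (hw.rpow_of_pos hpos (q - 1)).differentiable (by simp) x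
    have hp := (hw.pd i).differentiable (by simp) x
    rw [h1, pd_const_mul (hr.fun_mul hp), pd_mul hr hp,
      pd_rpow (hw.differentiable (by simp) x) (hpos x).ne', Real.rpow_sub_one (hpos x).ne' (q - 1)]
    ring
  simp only [lap, h2, Finset.sum_add_distrib, ← Finset.mul_sum]
  ring

theorem integral_rpow_mul_lap_add (hw : ContDiff ℝ (⊤ : ℕ∞) w) (hpos : ∀ x, 0 < w x)
    (hper : IsLatticePeriodic w) (m κ : ℝ) :
    ∫ x in Set.Icc (0 : Fin d → ℝ) 1, w x ^ m * (lap w x + κ * (∑ i, pd i w x ^ 2) / w x)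
      = (κ - m) * ∫ x in Set.Icc (0 : Fin d → ℝ) 1, w x ^ (m - 1) * ∑ i, pd i w x ^ 2 := by
  have hne : ∀ x, w x ≠ 0 := fun x => (hpos x).ne'
  have hS : Continuous fun y => ∑ j, pd j w y ^ 2 :=
    continuous_finsetSum _ fun j _ => (hw.pd j).continuous.pow 2
  have hm := hw.rpow_of_pos hpos m
  have hc : Continuous fun x => w x ^ (m - 1) * ∑ i, pd i w x ^ 2 :=
    (hw.rpow_of_pos hpos (m - 1)).continuous.mul hS
  have h := integral_sum_pd_mul_pd hw hm hper fun x k => by simp only [hper x k]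
  have h1 : ∀ x, ∑ i, pd i w x * pd i (fun y => w y ^ m) x
      = m * (w x ^ (m - 1) * ∑ i, pd i w x ^ 2) := by
    intro x
    simp only [pd_rpow (hw.differentiable (by simp) x) (hne x), Finset.mul_sum]
    exact Finset.sum_congr rfl fun i _ => by ring
  have h2 : ∀ x, w x ^ m * (lap w x + κ * (∑ i, pd i w x ^ 2) / w x)
      = κ * (w x ^ (m - 1) * ∑ i, pd i w x ^ 2) - -(lap w x * w x ^ m) := by
    intro x
    rw [Real.rpow_sub_one (hne x)]
    ring
  simp only [h1, integral_const_mul] at h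
  simp only [h2]
  have hl : Continuous fun x => -(lap w x * w x ^ m) :=
    (hw.lap.continuous.mul hm.continuous).neg
  rw [integral_sub (hc.const_mul _).integrableOn_Icc hl.integrableOn_Icc, ← h, integral_const_mul]
  ring

theorem integral_Icc_pos {f : (Fin d → ℝ) → ℝ} (hf : Continuous f) (hpos : ∀ x, 0 < f x) :
    0 < ∫ x in Set.Icc (0 : Fin d → ℝ) 1, f x := by
  rw [setIntegral_pos_iff_support_of_nonneg_ae
    (Filter.Eventually.of_forall fun x => (hpos x).le) hf.integrableOn_Icc,
    show Function.support f = Set.univ from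
      Set.eq_univ_of_forall fun x => (hpos x).ne', Set.univ_inter, Real.volume_Icc_pi]
  simp

variable {u : ℝ × (Fin d → ℝ) → ℝ} {β κ : ℝ}

theorem fderiv_rpow_time_eq (hu : ContDiff ℝ (⊤ : ℕ∞) u) (hpos : ∀ z, 0 < u z)
    (hflow : ∀ t x, deriv (fun s => u (s, x)) t
      = u (t, x) ^ (2 - 2 * β) *
        (lap (fun y => u (t, y)) x
          + κ * (∑ i, (pd i (fun y => u (t, y)) x) ^ 2) / u (t, x)))
    (q t : ℝ) (x : Fin d → ℝ) :
    fderiv ℝ (fun z => u z ^ q) (t, x) (1, 0)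
      = q * (u (t, x) ^ (q + 1 - 2 * β) * (lap (fun y => u (t, y)) x
          + κ * (∑ i, (pd i (fun y => u (t, y)) x) ^ 2) / u (t, x))) := by
  have h1 := hasDerivAt_slice ((hu.rpow_of_pos hpos q).differentiable (by simp)) t x
  have h2 := (hasDerivAt_slice (hu.differentiable (by simp)) t x).differentiableAt.hasDerivAt
  rw [h1.unique (h2.rpow_const (p := q) (Or.inl (hpos _).ne')), hflow,
    show q + 1 - 2 * β = (2 - 2 * β) + (q - 1) by ring, Real.rpow_add (hpos _)]
  ring

theorem hasDerivAt_integral_rpow (hu : ContDiff ℝ (⊤ : ℕ∞) u) (hpos : ∀ z, 0 < u z)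
    (hper : ∀ t, IsLatticePeriodic fun y => u (t, y))
    (hflow : ∀ t x, deriv (fun s => u (s, x)) t
      = u (t, x) ^ (2 - 2 * β) *
        (lap (fun y => u (t, y)) x
          + κ * (∑ i, (pd i (fun y => u (t, y)) x) ^ 2) / u (t, x)))
    (q t : ℝ) :
    HasDerivAt (fun s => ∫ x in Set.Icc (0 : Fin d → ℝ) 1, u (s, x) ^ q)
      (q * ((κ - (q + 1 - 2 * β)) * ∫ x in Set.Icc (0 : Fin d → ℝ) 1,
        u (t, x) ^ (q - 2 * β) * ∑ i, pd i (fun y => u (t, y)) x ^ 2)) t := by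
  have h := hasDerivAt_integral_slice (hu.rpow_of_pos hpos q) t
  have hw : ContDiff ℝ (⊤ : ℕ∞) fun y => u (t, y) := hu.comp (contDiff_prodMk_right t)
  simp only [fderiv_rpow_time_eq hu hpos hflow] at h
  rw [integral_const_mul,
    integral_rpow_mul_lap_add hw (fun x => hpos _) (hper t),
    show q + 1 - 2 * β - 1 = q - 2 * β by ring] at h
  exact h

theorem hasDerivAt_integral_normSq_pd_rpow (hu : ContDiff ℝ (⊤ : ℕ∞) u) (hpos : ∀ z, 0 < u z)
    (hper : ∀ t, IsLatticePeriodic fun y => u (t, y))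
    (hflow : ∀ t x, deriv (fun s => u (s, x)) t
      = u (t, x) ^ (2 - 2 * β) *
        (lap (fun y => u (t, y)) x
          + κ * (∑ i, (pd i (fun y => u (t, y)) x) ^ 2) / u (t, x)))
    (t : ℝ) :
    HasDerivAt (fun s => ∫ x in Set.Icc (0 : Fin d → ℝ) 1,
        ∑ i, pd i (fun y => u (s, y) ^ β) x ^ 2)
      (-(2 * β ^ 2) * ∫ x in Set.Icc (0 : Fin d → ℝ) 1,
        (lap (fun y => u (t, y)) x
            + (β - 1) * (∑ i, pd i (fun y => u (t, y)) x ^ 2) / u (t, x))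
          * (lap (fun y => u (t, y)) x
            + κ * (∑ i, pd i (fun y => u (t, y)) x ^ 2) / u (t, x))) t := by
  set V : ℝ × (Fin d → ℝ) → ℝ := fun z => u z ^ β with hV
  have hVs : ContDiff ℝ (⊤ : ℕ∞) V := hu.rpow_of_pos hpos β
  have hVd : Differentiable ℝ V := hVs.differentiable (by simp)
  have hw : ContDiff ℝ (⊤ : ℕ∞) fun y => u (t, y) := hu.comp (contDiff_prodMk_right t)
  have hv : ContDiff ℝ (⊤ : ℕ∞) fun y => V (t, y) := hVs.comp (contDiff_prodMk_right t)
  have hVt : ContDiff ℝ (⊤ : ℕ∞) fun y => fderiv ℝ V (t, y) (1, 0) :=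
    (hVs.fderiv_apply_const (1, 0)).comp (contDiff_prodMk_right t)
  have hslice : ∀ s x i, pd i (fun y => u (s, y) ^ β) x
      = fderiv ℝ V (s, x) (0, Pi.single i 1) := fun s x i => pd_slice hVd i s x
  have hG : ContDiff ℝ (⊤ : ℕ∞) fun z => ∑ i : Fin d, fderiv ℝ V z (0, Pi.single i 1) ^ 2 :=
    ContDiff.sum fun i _ => (hVs.fderiv_apply_const _).pow 2
  have h := hasDerivAt_integral_slice hG t
  simp only [hslice]
  convert h using 1
  have hG' : ∀ x, fderiv ℝ (fun z => ∑ i : Fin d, fderiv ℝ V z (0, Pi.single i 1) ^ 2) (t, x)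
        (1, 0)
      = 2 * ∑ i, pd i (fun y => V (t, y)) x * pd i (fun y => fderiv ℝ V (t, y) (1, 0)) x := by
    intro x
    have hd : ∀ i : Fin d, DifferentiableAt ℝ (fun z => fderiv ℝ V z (0, Pi.single i 1)) (t, x) :=
      fun i => (hVs.fderiv_apply_const _).differentiable (by simp) _
    rw [fderiv_fun_sum fun i _ => (hd i).fun_pow 2, Finset.mul_sum]
    simp only [sum_apply]
    refine Finset.sum_congr rfl fun i _ => ?_
    rw [pd_slice hVd, pd_slice ((hVs.fderiv_apply_const _).differentiable (by simp)),
      hVs.fderiv_fderiv_apply_comm (1, 0), fderiv_fun_pow 2 (hd i)]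
    simp
    ring
  have hper_v : IsLatticePeriodic fun y => V (t, y) := fun x k => by
    have h1 := hper t x k
    simp only at h1
    simp only [hV, h1]
  have hVt_eq : ∀ x, fderiv ℝ V (t, x) (1, 0) = _ := fderiv_rpow_time_eq hu hpos hflow β t
  have hper_Vt : IsLatticePeriodic fun y => fderiv ℝ V (t, y) (1, 0) := fun x k => by
    have h1 := hper t x k
    simp only at h1
    simp only [hVt_eq, (hper t).lap x k, fun i => (hper t).pd i x k, h1]
  simp only [hG', integral_const_mul]
  rw [integral_sum_pd_mul_pd hv hVt hper_v hper_Vt, ← integral_const_mul, ← integral_const_mul]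
  refine integral_congr_ae (Filter.Eventually.of_forall fun x => ?_)
  have hβ : u (t, x) ^ (β - 1) * u (t, x) ^ (β + 1 - 2 * β) = 1 := by
    rw [← Real.rpow_add (hpos _)]
    ring_nf
    exact Real.rpow_zero _
  have hlap : lap (fun y => V (t, y)) x = _ := lap_rpow hw (fun x => hpos _) β x
  simp only [hVt_eq, hlap]
  linear_combination (-2 * β ^ 2 * (lap (fun y => u (t, y)) x
            + (β - 1) * (∑ i, pd i (fun y => u (t, y)) x ^ 2) / u (t, x))
          * (lap (fun y => u (t, y)) x
            + κ * (∑ i, pd i (fun y => u (t, y)) x ^ 2) / u (t, x))) * (-hβ)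

end Flow

/-- The key monotonicity identity of the flow method on the flat torus: with
θ = (d−1)²(p−1)/(d(d+2)+p−1) and β = (d+2)/(d+3−p), along the flow
∂ₜu = u^{2−2β}(Δu + κ|∇u|²/u), the derivative of the interpolation functional is
F'(t) = 2β²(−(1−θ)∫(Δu)² − (θd/(d−1))∫‖Q u‖² + λ∫|∇u|²). -/
theorem key_monotonicity_identity (d : ℕ) (hd : 2 ≤ d) (lam p : ℝ)
    (hp1 : 1 < p) (hp2 : p ≠ 2) (hp3 : p ≠ (d : ℝ) + 3)
    (θ β κ : ℝ)
    (hθ : θ = ((d : ℝ) - 1) ^ 2 * (p - 1) / ((d : ℝ) * ((d : ℝ) + 2) + p - 1))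
    (hβ : β = ((d : ℝ) + 2) / ((d : ℝ) + 3 - p))
    (hκ : κ = 1 + β * (p - 2))
    (u : ℝ × (Fin d → ℝ) → ℝ) (hu : ContDiff ℝ (⊤ : ℕ∞) u)
    (hpos : ∀ t x, 0 < u (t, x))
    (hper : ∀ (t : ℝ) (x : Fin d → ℝ) (k : Fin d → ℤ),
      u (t, x + fun i => (k i : ℝ)) = u (t, x))
    (hflow : ∀ t x, deriv (fun s => u (s, x)) t
      = u (t, x) ^ (2 - 2 * β) *
        (lap (fun y => u (t, y)) x
          + κ * (∑ i, (pd i (fun y => u (t, y)) x) ^ 2) / u (t, x)))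
    (F : ℝ → ℝ)
    (hF : F = fun t =>
      (∫ x in Set.Icc (0 : Fin d → ℝ) 1,
          ∑ i, (pd i (fun y => u (t, y) ^ β) x) ^ 2)
      + (lam / (p - 2)) *
        ((∫ x in Set.Icc (0 : Fin d → ℝ) 1, u (t, x) ^ (2 * β))
          - (∫ x in Set.Icc (0 : Fin d → ℝ) 1, u (t, x) ^ (β * p)) ^ (2 / p))) :
    ∀ t : ℝ, HasDerivAt F
      (2 * β ^ 2 *
        (- (1 - θ) * (∫ x in Set.Icc (0 : Fin d → ℝ) 1, (lap (fun y => u (t, y)) x) ^ 2)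
          - (θ * (d : ℝ) / ((d : ℝ) - 1)) *
            (∫ x in Set.Icc (0 : Fin d → ℝ) 1,
              ∑ i, ∑ j, (Qmat θ β κ (fun y => u (t, y)) i j x) ^ 2)
          + lam * ∫ x in Set.Icc (0 : Fin d → ℝ) 1,
              ∑ i, (pd i (fun y => u (t, y)) x) ^ 2)) t := by
  intro t
  have hpos' : ∀ z, 0 < u z := fun z => hpos z.1 z.2
  have hper' : ∀ t, IsLatticePeriodic fun y => u (t, y) := fun t x k => hper t x k
  have hw : ContDiff ℝ (⊤ : ℕ∞) fun y => u (t, y) := hu.comp (contDiff_prodMk_right t)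
  have hd' : (2 : ℝ) ≤ d := by exact_mod_cast hd
  have hp2' : p - 2 ≠ 0 := sub_ne_zero.2 hp2
  have hp3' : (d : ℝ) + 3 - p ≠ 0 := sub_ne_zero.2 hp3.symm
  have hp1' : p - 1 ≠ 0 := by linarith
  have hd1 : (d : ℝ) - 1 ≠ 0 := by linarith
  have hd2 : (d : ℝ) + 2 ≠ 0 := by linarith
  have hden : (d : ℝ) * ((d : ℝ) + 2) + p - 1 ≠ 0 := by nlinarith
  have hθ0 : θ ≠ 0 := by
    rw [hθ]
    exact div_ne_zero (mul_ne_zero (pow_ne_zero 2 hd1) hp1') hden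
  have hA : κ + β - 1 = β * (p - 1) := by
    rw [hκ]
    ring
  have hμ : κ * (β - 1) = 1 / θ * (((d : ℝ) - 1) / ((d : ℝ) + 2)) ^ 2 * (κ + β - 1) ^ 2
      - d / ((d : ℝ) + 2) * (κ + β - 1) := by
    rw [hA, hκ, hθ, hβ]
    field_simp
    ring
  have h1 := hasDerivAt_integral_normSq_pd_rpow hu hpos' hper' hflow t
  rw [integral_dissipation_eq hd hθ0 hμ hw (fun x => hpos t x) (hper' t)] at h1
  have h2 := hasDerivAt_integral_rpow hu hpos' hper' hflow (2 * β) t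
  have h3 := hasDerivAt_integral_rpow hu hpos' hper' hflow (β * p) t
  have h3_pos : 0 < ∫ x in Set.Icc (0 : Fin d → ℝ) 1, u (t, x) ^ (β * p) :=
    integral_Icc_pos (hw.rpow_of_pos (fun x => hpos t x) _).continuous
      fun x => Real.rpow_pos_of_pos (hpos t x) _
  have h4 := h1.add ((h2.sub (h3.rpow_const (p := 2 / p) (Or.inl h3_pos.ne'))).const_mul
    (lam / (p - 2)))
  rw [hF]
  refine h4.congr_deriv ?_
  rw [show κ - (β * p + 1 - 2 * β) = 0 by rw [hκ]; ring,
    show κ - (2 * β + 1 - 2 * β) = β * (p - 2) by rw [hκ]; ring]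
  simp only [sub_self, Real.rpow_zero, one_mul, zero_mul, mul_zero, sub_zero]
  field_simp
  ring
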